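/- Let s = (q⃗, w⃗) ∈ RS(S) be a reachable configuration of the composed system S = S1 ⋈_{H,K} S2 such that both gateway states q_H and q_K are final. Then the buffers between the two gateways are empty: w_HK = w_KH = ε. -/

import Mathlib

/- Common formalization of Communicating Finite State Machines (CFSMs),
communicating systems, gateways and their composition, following
"Global Types with Internal Delegation" / GTIR paper definitions. -/

namespace GTIR

/-- Polarity of an action: `!` (send) or `?` (receive). -/
inductive Pol : Type
  | bang
  | query
deriving DecidableEq

/-- Dual polarity: swap `!` and `?`. -/
def Pol.dual : Pol → Pol
  | .bang => .query
  | .query => .bang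

/-- Actions over roles `R` and messages `A`:
`snd s r a` is `sr!a` (s sends `a` to r), `rcv s r a` is `sr?a`
(r receives/consumes `a` sent by s). -/
inductive Act (R A : Type) : Type
  | snd : R → R → A → Act R A
  | rcv : R → R → A → Act R A

/-- The action is a send action. -/
def Act.isSend {R A : Type} : Act R A → Prop
  | .snd _ _ _ => True
  | .rcv _ _ _ => False

/-- The action is a receive action. -/
def Act.isRecv {R A : Type} : Act R A → Prop
  | .snd _ _ _ => False
  | .rcv _ _ _ => True

/-- Erase the channel name of an action: `pq!a ↦ !a`, `pq?a ↦ ?a`. -/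
def Act.noC {R A : Type} : Act R A → Pol × A
  | .snd _ _ a => (.bang, a)
  | .rcv _ _ a => (.query, a)

/-- The dual of a word over `{!,?} × A`: swap `!` and `?` pointwise. -/
def dualWord {A : Type} (w : List (Pol × A)) : List (Pol × A) :=
  w.map fun x => (x.1.dual, x.2)

/-- Universal state type: base states from `B`, plus arbitrarily nested fresh
"hat" states (one for each transition) used by the gateway construction. -/
inductive St (R A B : Type) : Type
  | base : B → St R A B
  | hat : St R A B → Act R A → St R A B → St R A B

/-- A communicating finite state machine over roles `R` and messages `A`,
with states taken from `St R A B`: an initial state together with a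
transition relation. -/
structure CFSM (R A B : Type) where
  init : St R A B
  delta : Set (St R A B × Act R A × St R A B)

namespace CFSM

variable {R A B : Type}

/-- A state is final if it has no outgoing transition. -/
def Final (M : CFSM R A B) (q : St R A B) : Prop :=
  ∀ l q', (q, l, q') ∉ M.delta

/-- A sending state: non-final, and all outgoing transitions are sends. -/
def Sending (M : CFSM R A B) (q : St R A B) : Prop :=
  (∃ l q', (q, l, q') ∈ M.delta) ∧ ∀ l q', (q, l, q') ∈ M.delta → l.isSend

/-- A receiving state: non-final, and all outgoing transitions are receives. -/
def Receiving (M : CFSM R A B) (q : St R A B) : Prop :=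
  (∃ l q', (q, l, q') ∈ M.delta) ∧ ∀ l q', (q, l, q') ∈ M.delta → l.isRecv

/-- A mixed state: it has both an outgoing send and an outgoing receive. -/
def Mixed (M : CFSM R A B) (q : St R A B) : Prop :=
  (∃ l q', (q, l, q') ∈ M.delta ∧ l.isSend) ∧
  (∃ l q', (q, l, q') ∈ M.delta ∧ l.isRecv)

/-- `M` has no mixed states. -/
def NoMixed (M : CFSM R A B) : Prop := ∀ q, ¬ M.Mixed q

/-- `?`-determinism: two receives of the same message from the same state
(possibly on different channels) have the same target. -/
def QDet (M : CFSM R A B) : Prop :=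
  ∀ q a s r s' r' q' q'', (q, Act.rcv s r a, q') ∈ M.delta →
    (q, Act.rcv s' r' a, q'') ∈ M.delta → q' = q''

/-- `!`-determinism: two sends of the same message from the same state
(possibly on different channels) have the same target. -/
def BDet (M : CFSM R A B) : Prop :=
  ∀ q a s r s' r' q' q'', (q, Act.snd s r a, q') ∈ M.delta →
    (q, Act.snd s' r' a, q'') ∈ M.delta → q' = q''

/-- `?!`-determinism. -/
def IODet (M : CFSM R A B) : Prop := M.QDet ∧ M.BDet

/-- Accepting runs from a given state (every state is accepting). -/
inductive Accepts (M : CFSM R A B) : St R A B → List (Act R A) → Prop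
  | nil (q : St R A B) : Accepts M q []
  | cons {q : St R A B} {l : Act R A} {q' : St R A B} {φ : List (Act R A)} :
      (q, l, q') ∈ M.delta → Accepts M q' φ → Accepts M q (l :: φ)

/-- The language of `M` over `Act`. -/
def lang (M : CFSM R A B) : Set (List (Act R A)) := {φ | M.Accepts M.init φ}

/-- The language of `M` with channel names erased. -/
def langNoC (M : CFSM R A B) : Set (List (Pol × A)) :=
  (fun φ => φ.map Act.noC) '' M.lang

/-- Compatibility `M ↔ M'`: the channel-erased language of `M` is the set of
duals of the channel-erased language of `M'`; moreover neither machine has a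
mixed state and both are `?!`-deterministic. -/
def Compat (M M' : CFSM R A B) : Prop :=
  M.langNoC = dualWord '' M'.langNoC ∧
  M.NoMixed ∧ M'.NoMixed ∧ M.IODet ∧ M'.IODet

/-- The machine of role `p` over the role set `P`: every transition label is
an action of `p` (a send `pr!a` or a receive `rp?a`) with partner `r ∈ P`. -/
def ActsFor (M : CFSM R A B) (p : R) (P : Set R) : Prop :=
  ∀ q l q', (q, l, q') ∈ M.delta →
    ∃ r a, r ∈ P ∧ r ≠ p ∧ (l = Act.snd p r a ∨ l = Act.rcv r p a)

/-- All states occurring in `M` are base states; this guarantees that the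
intermediate "hat" states of the gateway construction are fresh for `M`. -/
def HatFree (M : CFSM R A B) : Prop :=
  (∃ b, M.init = St.base b) ∧
  ∀ q l q', (q, l, q') ∈ M.delta →
    (∃ b, q = St.base b) ∧ (∃ b, q' = St.base b)

/-- The set `Q̂` of fresh intermediate gateway states of `M`
(one for each transition of `M`). -/
def hatStates (M : CFSM R A B) : Set (St R A B) :=
  {x | ∃ q l q', (q, l, q') ∈ M.delta ∧ x = St.hat q l q'}

/-- The gateway `gw(M_H, K)` of the machine `M` of role `H` towards role `K`:
each transition `t = (q, Hs!a, q')` of `M` is replaced by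
`(q, KH?a, q̂_t)` and `(q̂_t, Hs!a, q')`, and each transition
`t = (q, sH?a, q')` of `M` is replaced by `(q, sH?a, q̂_t)` and
`(q̂_t, HK!a, q')`. -/
def gw (M : CFSM R A B) (H K : R) : CFSM R A B where
  init := M.init
  delta :=
    {x | ∃ q s a q', (q, Act.snd H s a, q') ∈ M.delta ∧
      (x = (q, Act.rcv K H a, St.hat q (Act.snd H s a) q') ∨
       x = (St.hat q (Act.snd H s a) q', Act.snd H s a, q'))} ∪
    {x | ∃ q s a q', (q, Act.rcv s H a, q') ∈ M.delta ∧
      (x = (q, Act.rcv s H a, St.hat q (Act.rcv s H a) q') ∨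
       x = (St.hat q (Act.rcv s H a) q', Act.snd H K a, q'))}

end CFSM

/-- A communicating system: a set of roles together with a CFSM for each role. -/
structure CS (R A B : Type) where
  roles : Set R
  mach : R → CFSM R A B

namespace CS

variable {R A B : Type}

/-- Well-formedness: the machine of each role `p` of the system only carries
actions of `p` with partners among the system's roles. -/
def WF (S : CS R A B) : Prop :=
  ∀ p ∈ S.roles, (S.mach p).ActsFor p S.roles

/-- Each machine of the system has a finite transition relation
(hence finitely many relevant states). -/
def FiniteSys (S : CS R A B) : Prop :=
  ∀ p ∈ S.roles, (S.mach p).delta.Finite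

open scoped Classical in
/-- Composition `S1 ⋈_{H,K} S2`: the union of the two systems, where the
machines of the interface roles `H` and `K` are replaced by the gateways
`gw(M¹_H, K)` and `gw(M²_K, H)`. -/
noncomputable def compose (S1 S2 : CS R A B) (H K : R) : CS R A B where
  roles := S1.roles ∪ S2.roles
  mach := fun p =>
    if p = H then (S1.mach H).gw H K
    else if p = K then (S2.mach K).gw K H
    else if p ∈ S1.roles then S1.mach p
    else S2.mach p

end CS

/-- A configuration: a local state for every role and a buffer (word over the
messages) for every ordered channel. -/
structure Config (R A B : Type) where
  st : R → St R A B
  buf : R → R → List A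

/-- The initial configuration(s) of a system: every machine of the system is
in its initial state and all the system's buffers are empty. -/
def InitConf {R A B : Type} (S : CS R A B) (c : Config R A B) : Prop :=
  (∀ p ∈ S.roles, c.st p = (S.mach p).init) ∧
  (∀ p ∈ S.roles, ∀ q ∈ S.roles, c.buf p q = [])

/-- One asynchronous step of system `S`, labelled by an action:
a send `sr!a` appends `a` to the buffer of channel `sr`, a receive `sr?a`
removes `a` from the front of the buffer of channel `sr`; everything else is
unchanged. -/
def Step {R A B : Type} (S : CS R A B) (c : Config R A B) :
    Act R A → Config R A B → Prop
  | .snd s r a, c' =>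
      s ∈ S.roles ∧ (c.st s, Act.snd s r a, c'.st s) ∈ (S.mach s).delta ∧
      (∀ p, p ≠ s → c'.st p = c.st p) ∧
      c'.buf s r = c.buf s r ++ [a] ∧
      (∀ p q, ¬(p = s ∧ q = r) → c'.buf p q = c.buf p q)
  | .rcv s r a, c' =>
      r ∈ S.roles ∧ (c.st r, Act.rcv s r a, c'.st r) ∈ (S.mach r).delta ∧
      (∀ p, p ≠ r → c'.st p = c.st p) ∧
      c.buf s r = a :: c'.buf s r ∧
      (∀ p q, ¬(p = s ∧ q = r) → c'.buf p q = c.buf p q)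

/-- `RS(S)`: the configurations reachable from the initial configuration. -/
def Reach {R A B : Type} (S : CS R A B) (c : Config R A B) : Prop :=
  ∃ c₀, InitConf S c₀ ∧
    Relation.ReflTransGen (fun x y => ∃ l, Step S x l y) c₀ c

/-- Deadlock configuration: all the system's buffers are empty and every
machine is in a receiving state. -/
def DeadlockConf {R A B : Type} (S : CS R A B) (c : Config R A B) : Prop :=
  (∀ p ∈ S.roles, ∀ q ∈ S.roles, c.buf p q = []) ∧
  ∀ p ∈ S.roles, (S.mach p).Receiving (c.st p)

/-- A system is deadlock-free if no reachable configuration is a deadlock. -/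
def DeadlockFree {R A B : Type} (S : CS R A B) : Prop :=
  ∀ c, Reach S c → ¬ DeadlockConf S c

/-- Orphan-message configuration: every machine is in a final state but some
buffer of the system is non-empty. -/
def OrphanConf {R A B : Type} (S : CS R A B) (c : Config R A B) : Prop :=
  (∀ p ∈ S.roles, (S.mach p).Final (c.st p)) ∧
  ∃ p ∈ S.roles, ∃ q ∈ S.roles, c.buf p q ≠ []

/-- Unspecified reception configuration: some machine is in a receiving state
but each of its expected input buffers is non-empty and starts with a message
it cannot receive. -/
def UnspecConf {R A B : Type} (S : CS R A B) (c : Config R A B) : Prop :=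
  ∃ r ∈ S.roles, (S.mach r).Receiving (c.st r) ∧
    ∀ s a q', (c.st r, Act.rcv s r a, q') ∈ (S.mach r).delta →
      c.buf s r ≠ [] ∧ ∀ w, c.buf s r ≠ a :: w

/-- A system is safe if no reachable configuration is a deadlock,
an orphan-message, or an unspecified reception configuration. -/
def Safe {R A B : Type} (S : CS R A B) : Prop :=
  ∀ c, Reach S c →
    ¬ DeadlockConf S c ∧ ¬ OrphanConf S c ∧ ¬ UnspecConf S c

end GTIR

open GTIR

namespace GTIR

variable {R A B : Type}

def dl (x : Pol × A) : Pol × A := (x.1.dual, x.2)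

theorem dl_dl (x : Pol × A) : dl (dl x) = x := by
  rcases x with ⟨_ | _, a⟩ <;> rfl

theorem dualWord_dualWord (w : List (Pol × A)) : dualWord (dualWord w) = w := by
  induction w with
  | nil => rfl
  | cons x w ih =>
    have : dualWord (dualWord (x :: w)) = dl (dl x) :: dualWord (dualWord w) := rfl
    rw [this, ih, dl_dl]

/-- erased transition -/
def E (M : CFSM R A B) (q : St R A B) (x : Pol × A) (q' : St R A B) : Prop :=
  ∃ l, (q, l, q') ∈ M.delta ∧ l.noC = x

theorem E_det {M : CFSM R A B} (h : M.IODet) {q x q1 q2} (h1 : E M q x q1) (h2 : E M q x q2) :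
    q1 = q2 := by
  obtain ⟨l1, m1, rfl⟩ := h1
  obtain ⟨l2, m2, e⟩ := h2
  cases l1 <;> cases l2 <;> simp [Act.noC] at e
  · subst e; exact h.2 _ _ _ _ _ _ _ _ m1 m2
  · subst e; exact h.1 _ _ _ _ _ _ _ _ m1 m2

theorem E_nomix {M : CFSM R A B} (h : M.NoMixed) {q a b q1 q2} (h1 : E M q (.bang, a) q1)
    (h2 : E M q (.query, b) q2) : False := by
  obtain ⟨l1, m1, e1⟩ := h1
  obtain ⟨l2, m2, e2⟩ := h2
  apply h q
  refine ⟨⟨l1, q1, m1, ?_⟩, ⟨l2, q2, m2, ?_⟩⟩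
  · cases l1 <;> simp [Act.noC, Act.isSend] at *
  · cases l2 <;> simp [Act.noC, Act.isRecv] at *

/-- erased acceptance -/
def EA (M : CFSM R A B) (q : St R A B) (w : List (Pol × A)) : Prop :=
  ∃ φ, M.Accepts q φ ∧ φ.map Act.noC = w

theorem EA_nil (M : CFSM R A B) (q : St R A B) : EA M q [] := ⟨[], .nil q, rfl⟩

theorem EA_cons {M : CFSM R A B} {q x w} : EA M q (x :: w) ↔ ∃ q', E M q x q' ∧ EA M q' w := by
  constructor
  · rintro ⟨φ, hφ, e⟩
    cases hφ with
    | nil => simp at e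
    | cons hd ht =>
      simp at e
      exact ⟨_, ⟨_, hd, e.1⟩, _, ht, e.2⟩
  · rintro ⟨q', ⟨l, hl, e⟩, φ, hφ, e'⟩
    exact ⟨l :: φ, .cons hl hφ, by simp [e, e']⟩

def Du (M N : CFSM R A B) (p q : St R A B) : Prop := ∀ w, EA M p w ↔ EA N q (dualWord w)

theorem Du.symm {M N : CFSM R A B} {p q} (h : Du M N p q) : Du N M q p := by
  intro w
  rw [h (dualWord w), dualWord_dualWord]

theorem Du.step {M N : CFSM R A B} (hM : M.IODet) (hN : N.IODet) {p q x p'} (h : Du M N p q)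
    (e : E M p x p') : ∃ q', E N q (dl x) q' ∧ Du M N p' q' := by
  have h1 : EA N q (dl x :: []) := (h [x]).1 (EA_cons.2 ⟨p', e, EA_nil _ _⟩)
  obtain ⟨q', hq', -⟩ := EA_cons.1 h1
  refine ⟨q', hq', fun w => ⟨fun hw => ?_, fun hw => ?_⟩⟩
  · have : EA N q (dl x :: dualWord w) := (h (x :: w)).1 (EA_cons.2 ⟨p', e, hw⟩)
    obtain ⟨q2, h2, h3⟩ := EA_cons.1 this
    rwa [E_det hN hq' h2]
  · have : EA M p (x :: w) := (h (x :: w)).2 (EA_cons.2 ⟨q', hq', hw⟩)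
    obtain ⟨q2, h2, h3⟩ := EA_cons.1 this
    rwa [E_det hM e h2]

theorem Du.init {M N : CFSM R A B} (h : M.langNoC = dualWord '' N.langNoC) :
    Du M N M.init N.init := by
  intro w
  change w ∈ M.langNoC ↔ dualWord w ∈ N.langNoC
  rw [h]
  constructor
  · rintro ⟨v, hv, rfl⟩
    rwa [dualWord_dualWord]
  · intro hw
    exact ⟨_, hw, dualWord_dualWord w⟩

/-- path of sends -/
def Path (M : CFSM R A B) : St R A B → List A → St R A B → Prop
  | q, [], p => q = p
  | q, a :: w, p => ∃ q', E M q (.bang, a) q' ∧ Path M q' w p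

theorem Path.snoc {M : CFSM R A B} {q w p a p'} (h : Path M q w p) (e : E M p (.bang, a) p') :
    Path M q (w ++ [a]) p' := by
  induction w generalizing q with
  | nil => cases h; exact ⟨p', e, rfl⟩
  | cons b w ih =>
    obtain ⟨q', h1, h2⟩ := h
    exact ⟨q', h1, ih h2⟩

/-- `u` buffer from M to N, `v` back -/
def Half (M N : CFSM R A B) (x y : St R A B) (u v : List A) : Prop :=
  v = [] ∧ ∃ p, Path N y u p ∧ Du M N x p

def Inv (M N : CFSM R A B) (x y : St R A B) (u v : List A) : Prop :=
  Half M N x y u v ∨ Half N M y x v u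

theorem Inv.symm {M N : CFSM R A B} {x y u v} (h : Inv M N x y u v) : Inv N M y x v u := Or.symm h

theorem Inv.send {M N : CFSM R A B} (hM : M.IODet) (hN : N.IODet) (mM : M.NoMixed)
    {x y u v a x'} (h : Inv M N x y u v) (e : E M x (.query, a) x') :
    Inv M N x' y (u ++ [a]) v := by
  rcases h with ⟨hv, p, hp, hd⟩ | ⟨hu, p, hp, hd⟩
  · obtain ⟨p', h1, h2⟩ := hd.step hM hN e
    exact Or.inl ⟨hv, p', hp.snoc h1, h2⟩
  · subst hu
    cases v with
    | nil =>
      cases hp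
      obtain ⟨p', h1, h2⟩ := hd.symm.step hM hN e
      exact Or.inl ⟨rfl, p', ⟨p', h1, rfl⟩, h2⟩
    | cons b v =>
      obtain ⟨q', h1, h2⟩ := hp
      exact (E_nomix mM h1 e).elim

theorem Inv.recv {M N : CFSM R A B} (hM : M.IODet)
    {x y u v a x'} (h : Inv M N x y u (a :: v)) (e : E M x (.bang, a) x') :
    Inv M N x' y u v := by
  rcases h with ⟨hv, p, hp, hd⟩ | ⟨hu, p, hp, hd⟩
  · cases hv
  · obtain ⟨q', h1, h2⟩ := hp
    rw [← E_det hM e h1] at h2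
    exact Or.inr ⟨hu, p, h2, hd⟩

def eff : St R A B → St R A B
  | .base b => .base b
  | .hat _ (.snd _ _ _) q' => q'
  | .hat q (.rcv _ _ _) _ => q

def WFst (M : CFSM R A B) : St R A B → Prop
  | .base _ => True
  | .hat q l q' => (q, l, q') ∈ M.delta

theorem gw_step {M : CFSM R A B} {H K : R} {P : Set R} (hA : M.ActsFor H P) (hK : K ∉ P)
    (hf : M.HatFree) {x l y} (h : (x, l, y) ∈ (M.gw H K).delta) :
    WFst M y ∧
    ((∃ a, l = .snd H K a ∧ E M (eff x) (.query, a) (eff y)) ∨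
     (∃ a, l = .rcv K H a ∧ E M (eff x) (.bang, a) (eff y)) ∨
     (eff y = eff x ∧ ∃ s a, s ≠ K ∧ (l = .snd H s a ∨ l = .rcv s H a))) := by
  rcases h with ⟨q, s, a, q', ht, h | h⟩ | ⟨q, s, a, q', ht, h | h⟩ <;>
  · obtain ⟨rfl, rfl, rfl⟩ : _ ∧ _ ∧ _ := by simpa using h
    obtain ⟨⟨b, rfl⟩, ⟨b', rfl⟩⟩ := hf.2 _ _ _ ht
    have hs : s ≠ K := by
      obtain ⟨r, a', hr, -, h | h⟩ := hA _ _ _ ht <;> cases h <;> rintro rfl <;> exact hK hr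
    first
    | exact ⟨ht, .inr (.inl ⟨a, rfl, _, ht, rfl⟩)⟩
    | exact ⟨trivial, .inl ⟨a, rfl, _, ht, rfl⟩⟩
    | exact ⟨ht, .inr (.inr ⟨rfl, s, a, hs, .inr rfl⟩)⟩
    | exact ⟨trivial, .inr (.inr ⟨rfl, s, a, hs, .inl rfl⟩)⟩

theorem gw_final {M : CFSM R A B} {H K : R} {P : Set R} (hA : M.ActsFor H P) {x}
    (hw : WFst M x) (h : (M.gw H K).Final x) : ∀ z q', ¬ E M (eff x) z q' := by
  have key : ∀ q l q', (q, l, q') ∈ M.delta →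
      (∃ l' y, (q, l', y) ∈ (M.gw H K).delta) ∧
      (∃ l' y, (St.hat q l q', l', y) ∈ (M.gw H K).delta) := by
    intro q l q' ht
    obtain ⟨r, a, -, -, rfl | rfl⟩ := hA _ _ _ ht
    · exact ⟨⟨_, _, .inl ⟨q, r, a, q', ht, .inl rfl⟩⟩, ⟨_, _, .inl ⟨q, r, a, q', ht, .inr rfl⟩⟩⟩
    · exact ⟨⟨_, _, .inr ⟨q, r, a, q', ht, .inl rfl⟩⟩, ⟨_, _, .inr ⟨q, r, a, q', ht, .inr rfl⟩⟩⟩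
  cases x with
  | base b =>
    rintro z q' ⟨l, hl, -⟩
    obtain ⟨⟨l', y, h'⟩, -⟩ := key _ _ _ hl
    exact (h _ _ h').elim
  | hat q l q' =>
    obtain ⟨-, l', y, h'⟩ := key _ _ _ hw
    exact (h _ _ h').elim

def PInv (M N : CFSM R A B) (H K : R) (c : Config R A B) : Prop :=
  WFst M (c.st H) ∧ WFst N (c.st K) ∧
  Inv M N (eff (c.st H)) (eff (c.st K)) (c.buf H K) (c.buf K H)

theorem PInv.symm {M N : CFSM R A B} {H K : R} {c : Config R A B} (h : PInv M N H K c) :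
    PInv N M K H c := ⟨h.2.1, h.1, h.2.2.symm⟩

def mover : Act R A → R
  | .snd s _ _ => s
  | .rcv _ r _ => r

theorem PInv.step {M N : CFSM R A B} {S : CS R A B} {H K : R} {P : Set R}
    (hm : S.mach H = M.gw H K) (hHK : H ≠ K)
    (hA : M.ActsFor H P) (hK : K ∉ P) (hf : M.HatFree)
    (hM : M.IODet) (hN : N.IODet) (mM : M.NoMixed)
    {c c' : Config R A B} {l : Act R A} (h : PInv M N H K c) (hl : mover l = H)
    (hs : Step S c l c') : PInv M N H K c' := by
  obtain ⟨w1, w2, hi⟩ := h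
  cases l with
  | snd s r a =>
    obtain rfl : s = H := hl
    obtain ⟨-, ht, hst, hb, hb'⟩ := hs
    rw [hm] at ht
    obtain ⟨w1', hc⟩ := gw_step hA hK hf ht
    have e1 : c'.st K = c.st K := hst _ hHK.symm
    have e2 : c'.buf K s = c.buf K s := hb' _ _ (fun h => hHK h.1.symm)
    refine ⟨w1', by rwa [e1], ?_⟩
    rw [e1, e2]
    rcases hc with ⟨b, hb1, he⟩ | ⟨b, hb1, he⟩ | ⟨he, t, b, htK, hb1 | hb1⟩
    · cases hb1
      rw [hb]
      exact hi.send hM hN mM he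
    · cases hb1
    · cases hb1
      rw [he, hb' s K (fun h => htK h.2.symm)]
      exact hi
    · cases hb1
  | rcv s r a =>
    obtain rfl : r = H := hl
    obtain ⟨-, ht, hst, hb, hb'⟩ := hs
    rw [hm] at ht
    obtain ⟨w1', hc⟩ := gw_step hA hK hf ht
    have e1 : c'.st K = c.st K := hst _ hHK.symm
    have e2 : c'.buf r K = c.buf r K := hb' _ _ (fun h => hHK h.2.symm)
    refine ⟨w1', by rwa [e1], ?_⟩
    rw [e1, e2]
    rcases hc with ⟨b, hb1, he⟩ | ⟨b, hb1, he⟩ | ⟨he, t, b, htK, hb1 | hb1⟩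
    · cases hb1
    · cases hb1
      rw [hb] at hi
      exact hi.recv hM he
    · cases hb1
    · cases hb1
      rw [he, hb' K r (fun h => htK h.1.symm)]
      exact hi

theorem PInv.other {M N : CFSM R A B} {S : CS R A B} {H K : R}
    {c c' : Config R A B} {l : Act R A} (h : PInv M N H K c) (hl : mover l ≠ H)
    (hl' : mover l ≠ K) (hs : Step S c l c') : PInv M N H K c' := by
  have : c'.st H = c.st H ∧ c'.st K = c.st K ∧ c'.buf H K = c.buf H K ∧
      c'.buf K H = c.buf K H := by
    cases l with
    | snd s r a =>
      obtain ⟨-, ht, hst, hb, hb'⟩ := hs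
      exact ⟨hst _ hl.symm, hst _ hl'.symm, hb' _ _ (fun h => hl h.1.symm),
        hb' _ _ (fun h => hl' h.1.symm)⟩
    | rcv s r a =>
      obtain ⟨-, ht, hst, hb, hb'⟩ := hs
      exact ⟨hst _ hl.symm, hst _ hl'.symm, hb' _ _ (fun h => hl' h.2.symm),
        hb' _ _ (fun h => hl h.2.symm)⟩
  obtain ⟨a1, a2, a3, a4⟩ := this
  unfold PInv
  rw [a1, a2, a3, a4]
  exact h

end GTIR

/-- in a reachable configuration of the composed system in which
both gateway states are final, the buffers between the two gateways are empty. -/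
theorem stmt8_final_gateways_empty_buffers
    {R A B : Type} [Finite R] [Finite A]
    (S1 S2 : CS R A B) (H K : R)
    (hH : H ∈ S1.roles) (hK : K ∈ S2.roles)
    (hdisj : S1.roles ∩ S2.roles = ∅)
    (hcompat : (S1.mach H).Compat (S2.mach K))
    (hwf1 : S1.WF) (hwf2 : S2.WF)
    (hfin1 : S1.FiniteSys) (hfin2 : S2.FiniteSys)
    (hhf1 : (S1.mach H).HatFree) (hhf2 : (S2.mach K).HatFree)
    (c : Config R A B) (hc : Reach (CS.compose S1 S2 H K) c)
    (hfinH : ((S1.mach H).gw H K).Final (c.st H))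
    (hfinK : ((S2.mach K).gw K H).Final (c.st K)) :
    c.buf H K = [] ∧ c.buf K H = [] := by
  have hKn : K ∉ S1.roles := fun h => by
    have : K ∈ S1.roles ∩ S2.roles := ⟨h, hK⟩
    simp [hdisj] at this
  have hHn : H ∉ S2.roles := fun h => by
    have : H ∈ S1.roles ∩ S2.roles := ⟨hH, h⟩
    simp [hdisj] at this
  have hHK : H ≠ K := fun h => hKn (h ▸ hH)
  obtain ⟨hL, mM, mN, hM, hN⟩ := hcompat
  have m1 : (CS.compose S1 S2 H K).mach H = (S1.mach H).gw H K := by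
    simp [CS.compose]
  have m2 : (CS.compose S1 S2 H K).mach K = (S2.mach K).gw K H := by
    simp [CS.compose, hHK.symm]
  have r1 : H ∈ (CS.compose S1 S2 H K).roles := Or.inl hH
  have r2 : K ∈ (CS.compose S1 S2 H K).roles := Or.inr hK
  have inv : PInv (S1.mach H) (S2.mach K) H K c := by
    obtain ⟨c0, ⟨hi1, hi2⟩, hr⟩ := hc
    clear hfinH hfinK
    induction hr with
    | refl =>
      obtain ⟨b, hb⟩ := hhf1.1
      obtain ⟨b', hb'⟩ := hhf2.1
      have e1 : c0.st H = St.base b := by rw [hi1 _ r1, m1, ← hb]; rfl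
      have e2 : c0.st K = St.base b' := by rw [hi1 _ r2, m2, ← hb']; rfl
      unfold PInv
      rw [e1, e2, hi2 _ r1 _ r2, hi2 _ r2 _ r1]
      refine ⟨trivial, trivial, .inl ⟨rfl, St.base b', rfl, ?_⟩⟩
      have := Du.init hL
      rw [hb, hb'] at this
      exact this
    | tail _ hs ih =>
      obtain ⟨l, hs⟩ := hs
      by_cases h1 : mover l = H
      · exact ih.step m1 hHK (hwf1 H hH) hKn hhf1 hM hN mM h1 hs
      by_cases h2 : mover l = K
      · exact (ih.symm.step m2 hHK.symm (hwf2 K hK) hHn hhf2 hN hM mN h2 hs).symm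
      exact ih.other h1 h2 hs
  obtain ⟨w1, w2, ⟨hv, p, hp, -⟩ | ⟨hu, p, hp, -⟩⟩ := inv
  · refine ⟨?_, hv⟩
    have f := gw_final (hwf2 K hK) w2 hfinK
    cases hb : c.buf H K with
    | nil => rfl
    | cons a w =>
      rw [hb] at hp
      obtain ⟨q', h1, -⟩ := hp
      exact (f _ _ h1).elim
  · refine ⟨hu, ?_⟩
    have f := gw_final (hwf1 H hH) w1 hfinH
    cases hb : c.buf K H with
    | nil => rfl
    | cons a w =>
      rw [hb] at hp
      obtain ⟨q', h1, -⟩ := hp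
      exact (f _ _ h1).elim
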